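/- arXiv:2508.00037 — 2 statements merged into one kernel-verified Lean document; each statement's English description precedes it below -/
import Mathlib

section
/- (Gradient flow yields the diffusion propagation scheme.) Let N, d be positive integers, H₀ a real N×d matrix, ρ, α real numbers, and F a symmetric real N×N matrix with row-sum diagonal D = diag(Σ_j F_{ij}). Define E(H) = ‖H − H₀‖_F² + ρ Σ_{i,j} F_{ij} ‖h_j − h_i‖², where h_i is the i-th row of H. Then one gradient descent step on E, started from H₀ itself, equals a diffusion propagation update: H₀ − α ∇E(H₀) = (I − δ' D) H₀ + δ' F H₀, where δ' = 4αρ and ∇E denotes the gradient of E with respect to the Frobenius inner product. -/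
open Matrix BigOperators

attribute [local instance] Matrix.normedAddCommGroup Matrix.normedSpace

open Finset in
/-- Summation by parts for the Dirichlet form of a symmetric matrix `F`: it is represented by
twice the Laplacian `D - F`. -/
theorem sum_dirichlet_form_eq {n m : Type*} [Fintype n] [Fintype m] [DecidableEq n]
    {F : Matrix n n ℝ} (hF : F.IsSymm) (H V : Matrix n m ℝ) :
    ∑ i, ∑ j, F i j * ∑ k, (H j k - H i k) * (V j k - V i k) =
      2 * ((((Matrix.diagonal fun i => ∑ j, F i j) * H - F * H)ᵀ) * V).trace := by
  have swap : ∑ i, ∑ j, F i j * ∑ k, (H j k - H i k) * V j k =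
      ∑ i, ∑ j, F i j * ∑ k, (H i k - H j k) * V i k := by
    rw [sum_comm]
    refine sum_congr rfl fun i _ => sum_congr rfl fun j _ => ?_
    rw [hF.apply i j]
  have split : ∑ i, ∑ j, F i j * ∑ k, (H j k - H i k) * (V j k - V i k) =
      (∑ i, ∑ j, F i j * ∑ k, (H j k - H i k) * V j k) +
        ∑ i, ∑ j, F i j * ∑ k, (H i k - H j k) * V i k := by
    simp only [← sum_add_distrib, ← mul_add]
    refine sum_congr rfl fun i _ => sum_congr rfl fun j _ => ?_
    congr 1
    exact sum_congr rfl fun k _ => by ring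
  rw [split, swap, ← two_mul]
  congr 1
  simp only [Matrix.trace, Matrix.diag_apply, Matrix.mul_apply (M := Matrix.transpose _),
    Matrix.transpose_apply, Matrix.sub_apply, Matrix.diagonal_mul]
  rw [sum_comm (γ := m)]
  refine sum_congr rfl fun i _ => ?_
  simp only [mul_sum]
  rw [sum_comm]
  refine sum_congr rfl fun k _ => ?_
  rw [Matrix.mul_apply, sum_mul, ← sum_sub_distrib, sum_mul]
  exact sum_congr rfl fun j _ => by ring

/-- Gradient flow yields the diffusion propagation scheme:
for `E(H) = ‖H − H₀‖_F² + ρ ∑_{i,j} F i j ‖h_j − h_i‖²` and `∇E` the gradient of `E`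
with respect to the Frobenius inner product (characterized by
`fderiv ℝ E H V = ⟨∇E(H), V⟩_F`), one gradient descent step started from `H₀` equals
the diffusion propagation update `H₀ − α ∇E(H₀) = (I − δ'D) H₀ + δ' F H₀` with
`δ' = 4αρ` and `D = diag(∑ j, F i j)`. -/
theorem gradient_step_eq_diffusion_update
    (N d : ℕ) (hN : 0 < N) (hd : 0 < d)
    (H₀ : Matrix (Fin N) (Fin d) ℝ) (ρ α : ℝ)
    (F : Matrix (Fin N) (Fin N) ℝ) (hF : F.IsSymm)
    (E : Matrix (Fin N) (Fin d) ℝ → ℝ)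
    (hE : ∀ H, E H = (∑ i, ∑ k, (H i k - H₀ i k) ^ 2) +
        ρ * ∑ i, ∑ j, F i j * ∑ k, (H j k - H i k) ^ 2)
    (gradE : Matrix (Fin N) (Fin d) ℝ → Matrix (Fin N) (Fin d) ℝ)
    (hgrad : ∀ H V : Matrix (Fin N) (Fin d) ℝ,
        fderiv ℝ E H V = (((gradE H)ᵀ) * V).trace) :
    H₀ - α • gradE H₀ =
      ((1 : Matrix (Fin N) (Fin N) ℝ) -
          (4 * α * ρ) • (Matrix.diagonal fun i => ∑ j, F i j)) * H₀ +
        (4 * α * ρ) • (F * H₀) := by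
  have hentry : ∀ i k, Differentiable ℝ fun H : Matrix (Fin N) (Fin d) ℝ => H i k := fun i k =>
    (LinearMap.toContinuousLinearMap (Matrix.entryLinearMap ℝ ℝ i k)).differentiable
  have hdiff : Differentiable ℝ E := by
    rw [funext hE]
    fun_prop
  set L : Matrix (Fin N) (Fin d) ℝ :=
    (Matrix.diagonal fun i => ∑ j, F i j) * H₀ - F * H₀ with hL
  have hline : ∀ V : Matrix (Fin N) (Fin d) ℝ,
      fderiv ℝ E H₀ V = 4 * ρ * (Lᵀ * V).trace := by
    intro V
    have hquad : ∀ t : ℝ, E (H₀ + t • V) =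
        t ^ 2 * (∑ i, ∑ k, V i k ^ 2) +
        ρ * ((∑ i, ∑ j, F i j * ∑ k, (H₀ j k - H₀ i k) ^ 2) +
          2 * t * (∑ i, ∑ j, F i j * ∑ k, (H₀ j k - H₀ i k) * (V j k - V i k)) +
          t ^ 2 * ∑ i, ∑ j, F i j * ∑ k, (V j k - V i k) ^ 2) := by
      intro t
      rw [hE]
      congr 1
      · simp only [Matrix.add_apply, Matrix.smul_apply, smul_eq_mul, Finset.mul_sum]
        exact Finset.sum_congr rfl fun i _ => Finset.sum_congr rfl fun k _ => by ring
      · congr 1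
        simp only [Matrix.add_apply, Matrix.smul_apply, smul_eq_mul, Finset.mul_sum,
          ← Finset.sum_add_distrib]
        exact Finset.sum_congr rfl fun i _ => Finset.sum_congr rfl fun j _ =>
          Finset.sum_congr rfl fun k _ => by ring
    have hderiv := (hdiff H₀).hasFDerivAt.hasLineDerivAt V
    unfold HasLineDerivAt at hderiv
    rw [funext hquad, sum_dirichlet_form_eq hF] at hderiv
    refine hderiv.unique ?_
    have hsq : HasDerivAt (fun t : ℝ => t ^ 2) 0 0 := by simpa using hasDerivAt_pow 2 (0 : ℝ)
    have hlin : HasDerivAt (fun t : ℝ => 2 * t) 2 0 := by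
      simpa using (hasDerivAt_id (0 : ℝ)).const_mul 2
    refine ((hsq.mul_const _).add ((((hasDerivAt_const (0 : ℝ) _).add
      (hlin.mul_const _)).add (hsq.mul_const _)).const_mul ρ)).congr_deriv ?_
    rw [← hL]
    ring
  have hgradE : gradE H₀ = (4 * ρ) • L := by
    apply Matrix.transpose_injective
    refine Matrix.ext_iff_trace_mul_right.2 fun V => ?_
    rw [← hgrad, hline, Matrix.transpose_smul, Matrix.smul_mul, Matrix.trace_smul, smul_eq_mul]
  rw [hgradE, hL, Matrix.sub_mul, Matrix.one_mul, Matrix.smul_mul]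
  module
end

section
/- Let N, d be positive integers, H₀ a real N×d matrix, ρ ≥ 0, and F a symmetric real N×N matrix with row-sum diagonal D = diag(Σ_j F_{ij}) such that L = D − F is positive semidefinite. Define E(H) = ‖H − H₀‖_F² + ρ Σ_{i,j} F_{ij} ‖h_j − h_i‖². Suppose c ≥ 0 satisfies xᵀ L x ≤ c‖x‖² for all x ∈ ℝ^N, and let α ≥ 0 satisfy α(1 + 2ρc) ≤ 1. Then one gradient step does not increase the energy: E(H − α∇E(H)) ≤ E(H) for every H ∈ ℝ^{N×d}, where ∇E is the gradient of E with respect to the Frobenius inner product. -/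
open Matrix BigOperators

attribute [local instance] Matrix.normedAddCommGroup Matrix.normedSpace

/-- The Dirichlet form of a symmetric weight matrix is twice the quadratic form of its
Laplacian. -/
lemma sum_mul_sq_sub_eq_two_mul_laplacian {ι : Type*} [Fintype ι] [DecidableEq ι]
    (F : Matrix ι ι ℝ) (hF : F.IsSymm) (x : ι → ℝ) :
    ∑ i, ∑ j, F i j * (x j - x i) ^ 2 =
      2 * (x ⬝ᵥ (((Matrix.diagonal fun i => ∑ j, F i j) - F) *ᵥ x)) := by
  have hswap : ∑ i, ∑ j, F i j * x j ^ 2 = ∑ i, ∑ j, F i j * x i ^ 2 := by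
    rw [Finset.sum_comm]
    exact Finset.sum_congr rfl fun i _ => Finset.sum_congr rfl fun j _ => by rw [hF.apply]
  have hexpand : ∑ i, ∑ j, F i j * (x j - x i) ^ 2 =
      ∑ i, ∑ j, F i j * x j ^ 2 + ∑ i, ∑ j, F i j * x i ^ 2
        - 2 * ∑ i, ∑ j, x i * (F i j * x j) := by
    simp only [Finset.mul_sum, ← Finset.sum_add_distrib, ← Finset.sum_sub_distrib]
    exact Finset.sum_congr rfl fun i _ => Finset.sum_congr rfl fun j _ => by ring
  have hlap : x ⬝ᵥ (((Matrix.diagonal fun i => ∑ j, F i j) - F) *ᵥ x) =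
      ∑ i, ∑ j, F i j * x i ^ 2 - ∑ i, ∑ j, x i * (F i j * x j) := by
    rw [Matrix.sub_mulVec, dotProduct_sub]
    congr 1
    · simp only [dotProduct, Matrix.mulVec_diagonal, Finset.sum_mul, Finset.mul_sum]
      exact Finset.sum_congr rfl fun i _ => Finset.sum_congr rfl fun j _ => by ring
    · simp only [dotProduct, Matrix.mulVec, Finset.mul_sum]
  rw [hexpand, hswap, hlap]
  ring

/-- A Laplacian bound controls the matrix-valued Dirichlet form by the squared Frobenius norm. -/
lemma sum_mul_sum_sq_sub_le {ι κ : Type*} [Fintype ι] [DecidableEq ι] [Fintype κ]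
    (F : Matrix ι ι ℝ) (hF : F.IsSymm) (c : ℝ)
    (hcL : ∀ x : ι → ℝ,
      x ⬝ᵥ (((Matrix.diagonal fun i => ∑ j, F i j) - F) *ᵥ x) ≤ c * ∑ i, x i ^ 2)
    (V : Matrix ι κ ℝ) :
    ∑ i, ∑ j, F i j * ∑ k, (V j k - V i k) ^ 2 ≤ 2 * c * ∑ i, ∑ k, V i k ^ 2 := by
  have hcols : ∑ i, ∑ j, F i j * ∑ k, (V j k - V i k) ^ 2 =
      ∑ k, ∑ i, ∑ j, F i j * (V j k - V i k) ^ 2 := by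
    simp only [Finset.mul_sum]
    rw [Finset.sum_comm (s := (Finset.univ : Finset κ))]
    exact Finset.sum_congr rfl fun i _ => Finset.sum_comm
  rw [hcols, Finset.sum_comm (f := fun i k => V i k ^ 2), Finset.mul_sum]
  refine Finset.sum_le_sum fun k _ => ?_
  rw [sum_mul_sq_sub_eq_two_mul_laplacian F hF fun i => V i k]
  linarith [hcL fun i => V i k]

/-- If `f` is quadratic along a line through a point of differentiability, its derivative in the
direction of the line is the linear coefficient. -/
lemma fderiv_apply_eq_of_quadratic_on_line {W : Type*} [NormedAddCommGroup W] [NormedSpace ℝ W]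
    {f : W → ℝ} {x v : W} {b q : ℝ} (hf : DifferentiableAt ℝ f x)
    (h : ∀ t : ℝ, f (x + t • v) = f x + t * b + t ^ 2 * q) : fderiv ℝ f x v = b := by
  rw [← hf.lineDeriv_eq_fderiv, lineDeriv, funext h]
  have h₁ : HasDerivAt (fun t : ℝ => f x + t * b + t ^ 2 * q) b 0 := by
    exact ((((hasDerivAt_id (0 : ℝ)).mul_const b).const_add (f x)).add
      (((hasDerivAt_id (0 : ℝ)).pow 2).mul_const q)).congr_deriv (by simp)
  exact h₁.deriv

/-- For the regularized Dirichlet energy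
`E(H) = ‖H − H₀‖_F² + ρ ∑_{i,j} F i j ‖h_j − h_i‖²` with `ρ ≥ 0`, `F` symmetric with
positive semidefinite Laplacian `L = D − F`, if `c ≥ 0` satisfies `xᵀ L x ≤ c ‖x‖²`
for all `x`, and `α ≥ 0` satisfies `α (1 + 2ρc) ≤ 1`, then one gradient step does not
increase the energy: `E(H − α ∇E(H)) ≤ E(H)` for every `H`, where `∇E` is the gradient
of `E` with respect to the Frobenius inner product. -/
theorem gradient_step_decreases_energy
    (N d : ℕ) (hN : 0 < N) (hd : 0 < d)
    (H₀ : Matrix (Fin N) (Fin d) ℝ) (ρ : ℝ) (hρ : 0 ≤ ρ)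
    (F : Matrix (Fin N) (Fin N) ℝ) (hF : F.IsSymm)
    (hL : ∀ x : Fin N → ℝ,
        0 ≤ x ⬝ᵥ (((Matrix.diagonal fun i => ∑ j, F i j) - F) *ᵥ x))
    (c : ℝ) (hc : 0 ≤ c)
    (hcL : ∀ x : Fin N → ℝ,
        x ⬝ᵥ (((Matrix.diagonal fun i => ∑ j, F i j) - F) *ᵥ x) ≤ c * ∑ i, x i ^ 2)
    (α : ℝ) (hα : 0 ≤ α) (hstep : α * (1 + 2 * ρ * c) ≤ 1)
    (E : Matrix (Fin N) (Fin d) ℝ → ℝ)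
    (hE : ∀ H, E H = (∑ i, ∑ k, (H i k - H₀ i k) ^ 2) +
        ρ * ∑ i, ∑ j, F i j * ∑ k, (H j k - H i k) ^ 2)
    (gradE : Matrix (Fin N) (Fin d) ℝ → Matrix (Fin N) (Fin d) ℝ)
    (hgrad : ∀ H V : Matrix (Fin N) (Fin d) ℝ,
        fderiv ℝ E H V = (((gradE H)ᵀ) * V).trace) :
    ∀ H : Matrix (Fin N) (Fin d) ℝ, E (H - α • gradE H) ≤ E H := by
  intro H
  have hentry : ∀ i k, Differentiable ℝ (fun M : Matrix (Fin N) (Fin d) ℝ => M i k) :=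
    fun i k => (Matrix.entryLinearMap ℝ ℝ i k).toContinuousLinearMap.differentiable
  have hdiff : Differentiable ℝ E := by
    rw [funext hE]
    fun_prop
  set V := gradE H with hV
  have hline : ∀ t : ℝ, E (H + t • V) = E H
      + t * (∑ i, ∑ k, 2 * (H i k - H₀ i k) * V i k
        + ρ * ∑ i, ∑ j, F i j * ∑ k, 2 * (H j k - H i k) * (V j k - V i k))
      + t ^ 2 * (∑ i, ∑ k, V i k ^ 2 + ρ * ∑ i, ∑ j, F i j * ∑ k, (V j k - V i k) ^ 2) := by
    intro t
    have hfid : ∑ i, ∑ k, ((H + t • V) i k - H₀ i k) ^ 2 = ∑ i, ∑ k, (H i k - H₀ i k) ^ 2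
        + t * ∑ i, ∑ k, 2 * (H i k - H₀ i k) * V i k + t ^ 2 * ∑ i, ∑ k, V i k ^ 2 := by
      simp only [Finset.mul_sum, ← Finset.sum_add_distrib, Matrix.add_apply, Matrix.smul_apply,
        smul_eq_mul]
      exact Finset.sum_congr rfl fun i _ => Finset.sum_congr rfl fun k _ => by ring
    have hdir : ∑ i, ∑ j, F i j * ∑ k, ((H + t • V) j k - (H + t • V) i k) ^ 2 =
        ∑ i, ∑ j, F i j * ∑ k, (H j k - H i k) ^ 2
        + t * ∑ i, ∑ j, F i j * ∑ k, 2 * (H j k - H i k) * (V j k - V i k)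
        + t ^ 2 * ∑ i, ∑ j, F i j * ∑ k, (V j k - V i k) ^ 2 := by
      simp only [Finset.mul_sum, ← Finset.sum_add_distrib, Matrix.add_apply, Matrix.smul_apply,
        smul_eq_mul]
      exact Finset.sum_congr rfl fun i _ => Finset.sum_congr rfl fun j _ =>
        Finset.sum_congr rfl fun k _ => by ring
    rw [hE, hE, hfid, hdir]
    ring
  have hslope := (hgrad H V).symm.trans
    (fderiv_apply_eq_of_quadratic_on_line (hdiff H) hline)
  have hnorm : (Vᵀ * V).trace = ∑ i, ∑ k, V i k ^ 2 := by
    simp only [Matrix.trace, Matrix.diag_apply, Matrix.mul_apply, Matrix.transpose_apply, ← pow_two]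
    exact Finset.sum_comm
  rw [← hV, hnorm] at hslope
  have hstepE := hline (-α)
  rw [← hslope, neg_smul, ← sub_eq_add_neg] at hstepE
  rw [hstepE]
  have hcurv := mul_le_mul_of_nonneg_left (sum_mul_sum_sq_sub_le F hF c hcL V) hρ
  have hcurv' := mul_le_mul_of_nonneg_left hcurv (sq_nonneg α)
  have hS : 0 ≤ ∑ i, ∑ k, V i k ^ 2 := by positivity
  have hgain := mul_nonneg (mul_nonneg hα hS) (sub_nonneg.mpr hstep)
  linarith
end
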